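/- Let G be a finite connected bipartite graph. Then the G-homogeneous arithmetical rank of the toric ideal I_G equals its minimal number of generators: ara_G(I_G) = μ(I_G). -/

import Mathlib

open MvPolynomial

noncomputable section

/-- The exponent of the variable `t j` in the image of `x i`: it is `1` if the vertex `j`
is an endpoint of the edge `e i`, and `0` otherwise (incidence vector of the edge `e i`). -/
def incid {n m : ℕ} (e : Fin m → Sym2 (Fin n)) (i : Fin m) (j : Fin n) : ℕ :=
  if j ∈ e i then 1 else 0

/-- The `K`-algebra homomorphism `K[x_1,…,x_m] → K[t_1,…,t_n]` sending `x i` to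
`t_j t_k`, where `e i = {v_j, v_k}`. -/
def toricMap (K : Type*) [CommRing K] {n m : ℕ} (e : Fin m → Sym2 (Fin n)) :
    MvPolynomial (Fin m) K →ₐ[K] MvPolynomial (Fin n) K :=
  aeval fun i => ∏ j, X j ^ incid e i j

/-- The toric ideal `I_G` of the graph with edges `e`. -/
def toricIdeal (K : Type*) [CommRing K] {n m : ℕ} (e : Fin m → Sym2 (Fin n)) :
    Ideal (MvPolynomial (Fin m) K) :=
  RingHom.ker (toricMap K e)

/-- The minimal number of generators of an ideal. -/
def mu {R : Type*} [CommRing R] (I : Ideal R) : ℕ :=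
  sInf {s | ∃ F : Fin s → R, Ideal.span (Set.range F) = I}

/-- The `G`-degree of an exponent vector `u`: `deg_G(x^u) = u_1 a_1 + ⋯ + u_m a_m ∈ ℤ^n`. -/
def degG {n m : ℕ} (e : Fin m → Sym2 (Fin n)) (u : Fin m →₀ ℕ) : Fin n → ℤ :=
  fun j => ∑ i, (u i : ℤ) * (incid e i j : ℤ)

/-- A polynomial is `G`-homogeneous if all monomials appearing in it have the same
`G`-degree. -/
def IsGHomogeneous {K : Type*} [CommRing K] {n m : ℕ} (e : Fin m → Sym2 (Fin n))
    (p : MvPolynomial (Fin m) K) : Prop :=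
  ∀ u ∈ p.support, ∀ v ∈ p.support, degG e u = degG e v

/-- The `G`-homogeneous arithmetical rank: the least `s` such that there are `s`
`G`-homogeneous polynomials in `I` generating `I` up to radical. -/
def araG {K : Type*} [CommRing K] {n m : ℕ} (e : Fin m → Sym2 (Fin n))
    (I : Ideal (MvPolynomial (Fin m) K)) : ℕ :=
  sInf {s | ∃ F : Fin s → MvPolynomial (Fin m) K, (∀ i, IsGHomogeneous e (F i)) ∧
    (∀ i, F i ∈ I) ∧ (Ideal.span (Set.range F)).radical = I}

/-- The edge family `e` is bipartite: the vertices split into a set `A` and its complement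
such that every edge joins a vertex of `A` with a vertex outside `A`. -/
def IsBipartite {n m : ℕ} (e : Fin m → Sym2 (Fin n)) : Prop :=
  ∃ A : Set (Fin n), ∀ i : Fin m, ∀ v w : Fin n, e i = s(v, w) →
    ((v ∈ A ∧ w ∉ A) ∨ (v ∉ A ∧ w ∈ A))

/-! ### Degrees -/

lemma degG_add {n m : ℕ} (e : Fin m → Sym2 (Fin n)) (u v : Fin m →₀ ℕ) :
    degG e (u + v) = degG e u + degG e v := by
  funext w
  simp [degG, add_mul, Finset.sum_add_distrib]

lemma degG_zero {n m : ℕ} (e : Fin m → Sym2 (Fin n)) : degG e 0 = 0 := by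
  funext w
  simp [degG]

lemma degG_nonneg {n m : ℕ} (e : Fin m → Sym2 (Fin n)) (u : Fin m →₀ ℕ) (w : Fin n) :
    0 ≤ degG e u w :=
  Finset.sum_nonneg fun _ _ => by positivity

lemma degG_ne_zero_iff {n m : ℕ} (e : Fin m → Sym2 (Fin n)) (u : Fin m →₀ ℕ) (w : Fin n) :
    degG e u w ≠ 0 ↔ ∃ i, 0 < u i ∧ w ∈ e i := by
  have h0 : degG e u w = 0 ↔ ∀ i, (u i : ℤ) * (incid e i w : ℤ) = 0 := by
    unfold degG
    rw [Finset.sum_eq_zero_iff_of_nonneg (fun _ _ => by positivity)]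
    simp
  rw [ne_eq, h0]
  push Not
  refine exists_congr fun i => ?_
  by_cases hw : w ∈ e i <;> simp [incid, hw, Nat.pos_iff_ne_zero]

lemma degG_mono {n m : ℕ} (e : Fin m → Sym2 (Fin n)) {u v : Fin m →₀ ℕ} (h : u ≤ v)
    {w : Fin n} (hw : degG e v w = 0) : degG e u w = 0 := by
  obtain ⟨z, rfl⟩ := exists_add_of_le h
  have h1 := degG_nonneg e u w
  have h2 := degG_nonneg e z w
  rw [degG_add, Pi.add_apply] at hw
  omega

/-- A choice of endpoints of each edge, compatible with a bipartition. -/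
structure Bip {n m : ℕ} (e : Fin m → Sym2 (Fin n)) (a b : Fin m → Fin n) : Prop where
  eq : ∀ i, e i = s(a i, b i)
  ne : ∀ i j, a i ≠ b j
  inj : ∀ i j, a i = a j → b i = b j → i = j

lemma exists_bip {n m : ℕ} (e : Fin m → Sym2 (Fin n)) (he : Function.Injective e)
    (hbip : IsBipartite e) : ∃ a b, Bip e a b := by
  obtain ⟨A, hA⟩ := hbip
  have h : ∀ i, ∃ p : Fin n × Fin n, e i = s(p.1, p.2) ∧ p.1 ∈ A ∧ p.2 ∉ A := by
    intro i
    induction hi : e i using Sym2.ind with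
    | _ x y =>
      rcases hA i x y hi with h | h
      · exact ⟨(x, y), rfl, h.1, h.2⟩
      · exact ⟨(y, x), Sym2.eq_swap, h.2, h.1⟩
  choose p hp using h
  refine ⟨fun i => (p i).1, fun i => (p i).2, fun i => (hp i).1, ?_, ?_⟩
  · intro i j h
    exact (hp j).2.2 (h ▸ (hp i).2.1)
  · intro i j h1 h2
    apply he
    rw [(hp i).1, (hp j).1]
    rw [h1, h2]

section
variable {n m : ℕ} {e : Fin m → Sym2 (Fin n)} {a b : Fin m → Fin n}

lemma Bip.mem (h : Bip e a b) (w : Fin n) (i : Fin m) : w ∈ e i ↔ w = a i ∨ w = b i := by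
  rw [h.eq]; simp

lemma Bip.degG_single (h : Bip e a b) (i : Fin m) :
    degG e (Finsupp.single i 1) = Pi.single (a i) 1 + Pi.single (b i) 1 := by
  funext w
  have : degG e (Finsupp.single i 1) w = (incid e i w : ℤ) := by
    unfold degG
    rw [Finset.sum_eq_single i]
    · simp
    · intro j _ hj
      simp [Finsupp.single_eq_of_ne hj]
    · simp
  rw [this]
  have hne := h.ne i i
  simp only [incid, h.mem, Pi.add_apply, Pi.single_apply]
  by_cases h1 : w = a i
  · subst h1; simp [hne]
  · by_cases h2 : w = b i <;> simp [h1, h2, hne.symm]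

lemma Bip.sum_degG (h : Bip e a b) (u : Fin m →₀ ℕ) :
    ∑ w, degG e u w = 2 * (u.degree : ℤ) := by
  unfold degG
  rw [Finset.sum_comm, Finsupp.degree_eq_sum]
  push_cast
  rw [Finset.mul_sum]
  refine Finset.sum_congr rfl fun i _ => ?_
  rw [← Finset.mul_sum, mul_comm]
  congr 1
  have hne := h.ne i i
  have : ∀ w, (incid e i w : ℤ) = (if w = a i then 1 else 0) + (if w = b i then 1 else 0) := by
    intro w
    simp only [incid, h.mem]
    by_cases h1 : w = a i
    · subst h1; simp [hne]
    · by_cases h2 : w = b i <;> simp [h1, h2, hne.symm]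
  simp [this, Finset.sum_add_distrib]

lemma Bip.degree_eq (h : Bip e a b) {u v : Fin m →₀ ℕ} (huv : degG e u = degG e v) :
    u.degree = v.degree := by
  have h1 := h.sum_degG u
  have h2 := h.sum_degG v
  rw [huv] at h1
  omega

lemma Bip.eq_zero (h : Bip e a b) {u : Fin m →₀ ℕ} (hu : degG e u = 0) : u = 0 := by
  have := h.degree_eq (hu.trans (degG_zero e).symm)
  simpa [Finsupp.degree_eq_zero_iff] using this

lemma Bip.exists_b (h : Bip e a b) {u : Fin m →₀ ℕ} {i : Fin m} (hu : degG e u (b i) ≠ 0) :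
    ∃ j, 0 < u j ∧ b j = b i := by
  obtain ⟨j, hj, hm⟩ := (degG_ne_zero_iff e u _).1 hu
  rcases (h.mem _ _).1 hm with h1 | h1
  · exact absurd h1.symm (h.ne _ _)
  · exact ⟨j, hj, h1.symm⟩

lemma Bip.exists_a (h : Bip e a b) {u : Fin m →₀ ℕ} {i : Fin m} (hu : degG e u (a i) ≠ 0) :
    ∃ j, 0 < u j ∧ a j = a i := by
  obtain ⟨j, hj, hm⟩ := (degG_ne_zero_iff e u _).1 hu
  rcases (h.mem _ _).1 hm with h1 | h1
  · exact ⟨j, hj, h1.symm⟩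
  · exact absurd h1 (h.ne _ _)

lemma Bip.pos_b (h : Bip e a b) {u : Fin m →₀ ℕ} {i : Fin m} (hu : 0 < u i) :
    degG e u (b i) ≠ 0 :=
  (degG_ne_zero_iff e u _).2 ⟨i, hu, (h.mem _ _).2 (Or.inr rfl)⟩

lemma Bip.pos_a (h : Bip e a b) {u : Fin m →₀ ℕ} {i : Fin m} (hu : 0 < u i) :
    degG e u (a i) ≠ 0 :=
  (degG_ne_zero_iff e u _).2 ⟨i, hu, (h.mem _ _).2 (Or.inl rfl)⟩

/-- An alternating closed walk with edges `i t` from `u` and `j t` from `v`. -/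
structure AltCyc (a b : Fin m → Fin n) (u v : Fin m →₀ ℕ) (k : ℕ) (i j : ℕ → Fin m) : Prop where
  kpos : 0 < k
  ui : ∀ t, 0 < u (i t)
  vj : ∀ t, 0 < v (j t)
  bb : ∀ t, b (i t) = b (j t)
  aa : ∀ t, a (i (t + 1)) = a (j t)
  peri : ∀ t, i (t + k) = i t
  perj : ∀ t, j (t + k) = j t
  inji : ∀ s t, s < k → t < k → i s = i t → s = t
  injj : ∀ s t, s < k → t < k → j s = j t → s = t
  injb : ∀ s t, b (i s) = b (i t) → i s = i t ∧ j s = j t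
  inja : ∀ s t, a (i s) = a (i t) → i s = i t
  inja' : ∀ s t, a (j s) = a (j t) → i (s + 1) = i (t + 1) ∧ j s = j t

lemma Bip.exists_altCyc (h : Bip e a b) {u v : Fin m →₀ ℕ} (huv : degG e u = degG e v)
    (hu : u ≠ 0) : ∃ k i j, AltCyc a b u v k i j := by
  obtain ⟨x0, hx0⟩ : ∃ x, 0 < u x := by
    obtain ⟨x, hx⟩ := Finsupp.ne_iff.1 hu
    exact ⟨x, Nat.pos_of_ne_zero hx⟩
  have hH : ∀ w, ∃ y, (∃ y', 0 < v y' ∧ b y' = w) → 0 < v y ∧ b y = w := by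
    intro w
    by_cases hw : ∃ y', 0 < v y' ∧ b y' = w
    · obtain ⟨y, hy⟩ := hw
      exact ⟨y, fun _ => hy⟩
    · exact ⟨x0, fun h => absurd h hw⟩
  have hG : ∀ w, ∃ y, (∃ y', 0 < u y' ∧ a y' = w) → 0 < u y ∧ a y = w := by
    intro w
    by_cases hw : ∃ y', 0 < u y' ∧ a y' = w
    · obtain ⟨y, hy⟩ := hw
      exact ⟨y, fun _ => hy⟩
    · exact ⟨x0, fun h => absurd h hw⟩
  choose H hH using hH
  choose G hG using hG
  have h1 : ∀ x, 0 < u x → 0 < v (H (b x)) ∧ b (H (b x)) = b x := fun x hx =>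
    hH _ (h.exists_b (huv ▸ h.pos_b hx))
  have h2 : ∀ y, 0 < v y → 0 < u (G (a y)) ∧ a (G (a y)) = a y := fun y hy =>
    hG _ (h.exists_a (huv ▸ h.pos_a hy))
  let f : Fin m → Fin m := fun x => G (a (H (b x)))
  have hf : ∀ x, 0 < u x → 0 < u (f x) := fun x hx => (h2 _ (h1 x hx).1).1
  have hfi : ∀ t x, 0 < u x → 0 < u (f^[t] x) := by
    intro t
    induction t with
    | zero => intro x hx; exact hx
    | succ t ih => intro x hx; rw [Function.iterate_succ_apply]; exact ih _ (hf x hx)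
  -- a periodic point
  obtain ⟨s, t, hst, hne⟩ : ∃ s t, s < t ∧ f^[s] x0 = f^[t] x0 := by
    obtain ⟨s, t, hst, heq⟩ := Finite.exists_ne_map_eq_of_infinite (fun t : ℕ => f^[t] x0)
    rcases lt_or_gt_of_ne hst with h | h
    · exact ⟨s, t, h, heq⟩
    · exact ⟨t, s, h, heq.symm⟩
  set y := f^[s] x0 with hy
  have hyu : 0 < u y := hfi s x0 hx0
  have hper : y ∈ Function.periodicPts f := by
    refine Function.mk_mem_periodicPts (n := t - s) (by omega) ?_
    unfold Function.IsPeriodicPt Function.IsFixedPt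
    conv_lhs => rw [hy]
    rw [← Function.iterate_add_apply, Nat.sub_add_cancel hst.le, ← hne]
  set k := Function.minimalPeriod f y with hk
  have hkpos : 0 < k := Function.minimalPeriod_pos_of_mem_periodicPts hper
  let i : ℕ → Fin m := fun t => f^[t] y
  have hi : ∀ t, i (t + 1) = f (i t) := fun t => Function.iterate_succ_apply' f t y
  have hiper : ∀ t, i (t + k) = i t := fun t => Function.iterate_add_minimalPeriod_eq
  have hshift : ∀ s t, i (s + 1) = i (t + 1) → i s = i t := by
    intro s t hst
    have hc : ∀ r, i (s + 1 + r) = i (t + 1 + r) := by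
      intro r
      induction r with
      | zero => exact hst
      | succ r ih => rw [← add_assoc, ← add_assoc, hi, hi, ih]
    have := hc (k - 1)
    rwa [show s + 1 + (k - 1) = s + k by omega, show t + 1 + (k - 1) = t + k by omega,
      hiper, hiper] at this
  have hinji : ∀ s t, s < k → t < k → i s = i t → s = t := fun s t hs ht hst =>
    Function.iterate_injOn_Iio_minimalPeriod hs ht hst
  have hui : ∀ t, 0 < u (i t) := fun t => hfi t y hyu
  have haa : ∀ t, a (i (t + 1)) = a (H (b (i t))) := fun t => by
    rw [hi]; exact (h2 _ (h1 _ (hui t)).1).2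
  have hja : ∀ s t, a (H (b (i s))) = a (H (b (i t))) → i (s + 1) = i (t + 1) := by
    intro s t hst
    rw [hi, hi]
    show G _ = G _
    rw [hst]
  refine ⟨k, i, fun t => H (b (i t)), hkpos, hui, fun t => (h1 _ (hui t)).1,
    fun t => (h1 _ (hui t)).2.symm, haa, hiper, fun t => by simp only [hiper], hinji, ?_, ?_, ?_, ?_⟩
  · intro s t hs ht hst
    exact hinji s t hs ht (hshift _ _ (hja s t (congrArg a hst)))
  · intro s t hst
    have : H (b (i s)) = H (b (i t)) := by rw [hst]
    exact ⟨hshift _ _ (hja s t (congrArg a this)), this⟩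
  · intro s t hst
    have e1 : ∀ s, i s = i (s + (k - 1) + 1) := fun s => by
      rw [show s + (k - 1) + 1 = s + k by omega, hiper]
    rw [e1 s, e1 t] at hst ⊢
    rw [haa, haa] at hst
    exact hja _ _ hst
  · intro s t hst
    have := hja s t hst
    refine ⟨this, ?_⟩
    simp only [hshift s t this]

lemma AltCyc.shift {u v : Fin m →₀ ℕ} {k : ℕ} {i j : ℕ → Fin m} (h : AltCyc a b u v k i j)
    (s : ℕ) : AltCyc a b u v k (fun t => i (t + s)) (fun t => j (t + s)) := by
  have key : ∀ f : ℕ → Fin m, (∀ t, f (t + k) = f t) →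
      (∀ s t, s < k → t < k → f s = f t → s = t) →
      ∀ x y, x < k → y < k → f (x + s) = f (y + s) → x = y := by
    intro f hp hinj x y hx hy hxy
    have hmod : ∀ t, f (t % k) = f t := fun t => Function.Periodic.map_mod_nat hp t
    rw [← hmod, ← hmod (y + s)] at hxy
    have := hinj _ _ (Nat.mod_lt _ h.kpos) (Nat.mod_lt _ h.kpos) hxy
    have h2 : x ≡ y [MOD k] := Nat.ModEq.add_right_cancel' s this
    exact Nat.ModEq.eq_of_lt_of_lt h2 hx hy
  refine ⟨h.kpos, fun t => h.ui _, fun t => h.vj _, fun t => h.bb _, fun t => ?_, fun t => ?_,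
    fun t => ?_, key i h.peri h.inji, key j h.perj h.injj, fun _ _ => h.injb _ _,
    fun _ _ => h.inja _ _, fun x y hxy => ?_⟩
  · have := h.aa (t + s)
    rwa [show t + s + 1 = t + 1 + s by omega] at this
  · have := h.peri (t + s)
    rwa [show t + s + k = t + k + s by omega] at this
  · have := h.perj (t + s)
    rwa [show t + s + k = t + k + s by omega] at this
  · have := h.inja' _ _ hxy
    rwa [show x + s + 1 = x + 1 + s by omega, show y + s + 1 = y + 1 + s by omega] at this

/-- The exponent vector of the first `k` edges of a sequence. -/
def seqSum (f : ℕ → Fin m) (k : ℕ) : Fin m →₀ ℕ := ∑ t ∈ Finset.range k, Finsupp.single (f t) 1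

lemma seqSum_succ (f : ℕ → Fin m) (k : ℕ) :
    seqSum f (k + 1) = seqSum f k + Finsupp.single (f k) 1 := Finset.sum_range_succ _ _

lemma seqSum_degree (f : ℕ → Fin m) (k : ℕ) : (seqSum f k).degree = k := by
  induction k with
  | zero => simp [seqSum]
  | succ k ih => rw [seqSum_succ, map_add, ih]; simp

lemma seqSum_pos (f : ℕ → Fin m) (k : ℕ) (x : Fin m) (hx : 0 < seqSum f k x) :
    ∃ t < k, f t = x := by
  induction k with
  | zero => simp [seqSum] at hx
  | succ k ih =>
    rw [seqSum_succ, Finsupp.add_apply] at hx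
    by_cases hk : f k = x
    · exact ⟨k, by omega, hk⟩
    · rw [Finsupp.single_apply, if_neg hk] at hx
      obtain ⟨t, ht, h⟩ := ih (by omega)
      exact ⟨t, by omega, h⟩

lemma seqSum_le_one (f : ℕ → Fin m) (k : ℕ) (hf : ∀ s t, s < k → t < k → f s = f t → s = t)
    (x : Fin m) : seqSum f k x ≤ 1 := by
  induction k with
  | zero => simp [seqSum]
  | succ k ih =>
    rw [seqSum_succ, Finsupp.add_apply]
    have ih' := ih (fun s t hs ht => hf s t (by omega) (by omega))
    by_cases hk : f k = x
    · rw [Finsupp.single_apply, if_pos hk]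
      have : seqSum f k x = 0 := by
        by_contra hne
        obtain ⟨t, ht, h⟩ := seqSum_pos f k x (Nat.pos_of_ne_zero hne)
        have := hf t k (by omega) (by omega) (h.trans hk.symm)
        omega
      omega
    · rw [Finsupp.single_apply, if_neg hk]
      omega

lemma seqSum_le (f : ℕ → Fin m) (k : ℕ) (hf : ∀ s t, s < k → t < k → f s = f t → s = t)
    (u : Fin m →₀ ℕ) (hu : ∀ t, 0 < u (f t)) : seqSum f k ≤ u := by
  intro x
  by_cases hx : 0 < seqSum f k x
  · obtain ⟨t, -, rfl⟩ := seqSum_pos f k x hx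
    exact (seqSum_le_one f k hf _).trans (hu t)
  · omega

/-- Open alternating walks: `a` degrees are shifted. -/
lemma AltCyc.degG_path (hb : Bip e a b) {u v : Fin m →₀ ℕ} {k : ℕ} {i j : ℕ → Fin m}
    (h : AltCyc a b u v k i j) (t : ℕ) :
    degG e (seqSum i t) + Pi.single (a (i t)) 1 = degG e (seqSum j t) + Pi.single (a (i 0)) 1 := by
  induction t with
  | zero => simp [seqSum]
  | succ t ih =>
    rw [seqSum_succ, seqSum_succ, degG_add, degG_add, hb.degG_single, hb.degG_single, h.bb, h.aa]
    have : degG e (seqSum i t) + (Pi.single (a (i t)) 1 + Pi.single (b (j t)) 1) +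
        Pi.single (a (j t)) 1 = (degG e (seqSum i t) + Pi.single (a (i t)) 1)
          + Pi.single (b (j t)) 1 + Pi.single (a (j t)) 1 := by abel
    rw [this, ih]
    abel

lemma AltCyc.degG_cyc (hb : Bip e a b) {u v : Fin m →₀ ℕ} {k : ℕ} {i j : ℕ → Fin m}
    (h : AltCyc a b u v k i j) : degG e (seqSum i k) = degG e (seqSum j k) := by
  have h1 := h.degG_path hb k
  have h2 := h.peri 0
  rw [zero_add] at h2
  rw [h2] at h1
  exact add_right_cancel h1

/-- The two-term expansion of the degree at a vertex met by exactly two relevant edges. -/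
lemma degG_two {p : Fin m →₀ ℕ} {w : Fin n} {x y : Fin m} (hxy : x ≠ y) (hx : w ∈ e x)
    (hy : w ∈ e y) (h : ∀ z, 0 < p z → w ∈ e z → z = x ∨ z = y) :
    degG e p w = (p x : ℤ) + p y := by
  unfold degG
  rw [← Finset.sum_subset (Finset.subset_univ {x, y}), Finset.sum_pair hxy]
  · simp [incid, hx, hy]
  · intro z _ hz
    by_cases hw : w ∈ e z
    · have : p z = 0 := by
        by_contra h0
        apply hz
        rcases h z (Nat.pos_of_ne_zero h0) hw with rfl | rfl <;> simp
      simp [this]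
    · simp [incid, hw]

/-- Any additive congruence containing the pairs attached to minimal vertex sets contains
all pairs of equal degree. -/
theorem Bip.core (hb : Bip e a b) (P : AddCon (Fin m →₀ ℕ))
    (hP : ∀ u v, degG e u = degG e v → u ≠ v → ∃ p q, p ≠ q ∧ degG e p = degG e q ∧
      (∀ w, degG e u w = 0 → degG e p w = 0) ∧ P p q ∧
      ∀ p' q', p' ≠ q' → degG e p' = degG e q' → (∀ w, degG e p w = 0 → degG e p' w = 0) →
        p.degree ≤ p'.degree) :
    ∀ (N : ℕ) (u v : Fin m →₀ ℕ), u.degree = N → degG e u = degG e v → P u v := by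
  intro N
  induction N using Nat.strong_induction_on with
  | _ N IH =>
  intro u v hN huv
  have degpos : ∀ x : Fin m →₀ ℕ, x ≠ 0 → 0 < x.degree := fun x hx =>
    Nat.pos_of_ne_zero fun h => hx ((Finsupp.degree_eq_zero_iff x).1 h)
  have hsplit : ∀ u v : Fin m →₀ ℕ, u.degree = N → degG e u = degG e v →
      ∀ u0 v0 u1 v1, u0 + u1 = u → v0 + v1 = v → degG e u0 = degG e v0 →
      u0 ≠ 0 → u1 ≠ 0 → P u v := by
    intro u v hN huv u0 v0 u1 v1 hu hv h0 hu0 hu1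
    have h1 : degG e u1 = degG e v1 := by
      rw [← hu, ← hv, degG_add, degG_add, h0] at huv
      exact add_left_cancel huv
    have hd : u0.degree + u1.degree = N := by rw [← hN, ← hu, map_add]
    have := degpos _ hu0
    have := degpos _ hu1
    rw [← hu, ← hv]
    exact P.add (IH _ (by omega) u0 v0 rfl h0) (IH _ (by omega) u1 v1 rfl h1)
  have hshare : ∀ u v : Fin m →₀ ℕ, u.degree = N → degG e u = degG e v →
      ∀ x, 0 < u x → 0 < v x → P u v := by
    intro u v hN huv x hux hvx
    have h1 : Finsupp.single x 1 ≤ u := Finsupp.single_le_iff.2 hux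
    have h2 : Finsupp.single x 1 ≤ v := Finsupp.single_le_iff.2 hvx
    obtain ⟨u1, rfl⟩ := exists_add_of_le h1
    obtain ⟨v1, rfl⟩ := exists_add_of_le h2
    by_cases hu1 : u1 = 0
    · have : v1 = 0 := by
        rw [degG_add, degG_add] at huv
        have := add_left_cancel huv
        rw [hu1, degG_zero] at this
        exact hb.eq_zero this.symm
      rw [hu1, this]
      exact P.refl _
    · exact hsplit _ _ hN huv _ _ _ _ rfl rfl rfl (by simp) hu1
  by_contra hbad
  have hne : u ≠ v := by
    rintro rfl
    exact hbad (P.refl _)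
  have hu0 : u ≠ 0 := by
    rintro rfl
    rw [degG_zero] at huv
    exact hne (hb.eq_zero huv.symm).symm
  have hvN : v.degree = N := by rw [← hb.degree_eq huv, hN]
  have hdisj : ∀ x, 0 < u x → 0 < v x → False := fun x h1 h2 => hbad (hshare u v hN huv x h1 h2)
  have hfull : ∀ k i j, AltCyc a b u v k i j → u = seqSum i k ∧ v = seqSum j k := by
    intro k i j h
    obtain ⟨u1, hu1⟩ := exists_add_of_le (seqSum_le i k h.inji u h.ui)
    obtain ⟨v1, hv1⟩ := exists_add_of_le (seqSum_le j k h.injj v h.vj)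
    have hd := h.degG_cyc hb
    have hu1' : u1 = 0 := by
      by_contra hne
      refine hbad (hsplit u v hN huv _ _ _ _ hu1.symm hv1.symm hd ?_ hne)
      intro h0
      have := seqSum_degree i k
      rw [h0, map_zero] at this
      have := h.kpos
      omega
    have hv1' : v1 = 0 := by
      apply hb.eq_zero
      rw [hu1, hv1, degG_add, degG_add, hd] at huv
      have := add_left_cancel huv
      rw [← this, hu1', degG_zero]
    rw [hu1', add_zero] at hu1
    rw [hv1', add_zero] at hv1
    exact ⟨hu1, hv1⟩
  obtain ⟨k, i, j, h⟩ := hb.exists_altCyc huv hu0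
  -- chords
  have hchord : ∀ f, degG e u (a f) ≠ 0 → degG e u (b f) ≠ 0 → 0 < u f ∨ 0 < v f := by
    intro f hfa hfb
    obtain ⟨x, hx, hxa⟩ := hb.exists_a hfa
    obtain ⟨s, hs, rfl⟩ := seqSum_pos i k x (by rwa [← (hfull k i j h).1])
    have h' := h.shift s
    have ha0 : a (i (0 + s)) = a f := by rwa [zero_add]
    generalize hI : (fun t => i (t + s)) = I at h'
    generalize hJ : (fun t => j (t + s)) = J at h'
    have hI0 : a (I 0) = a f := by rw [← hI]; exact ha0
    obtain ⟨hu, hv⟩ := hfull k I J h'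
    obtain ⟨y, hy, hyb⟩ := hb.exists_b hfb
    obtain ⟨t, ht, rfl⟩ := seqSum_pos I k y (by rwa [← hu])
    by_cases ht0 : t = 0
    · subst ht0
      left
      rw [← hb.inj _ _ hI0 hyb]
      exact h'.ui 0
    by_cases htk : t = k - 1
    · right
      have hk := h.kpos
      have h1 : a (J t) = a f := by
        rw [← h'.aa, ← hI0, htk]
        have := h'.peri 0
        rw [show k - 1 + 1 = 0 + k by omega, this]
      have h2 : b (J t) = b f := by rw [← h'.bb, hyb]
      rw [← hb.inj _ _ h1 h2]
      exact h'.vj t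
    exfalso
    apply hbad
    have hle : seqSum I (t + 1) ≤ u := seqSum_le I (t + 1)
      (fun x y hx hy => h'.inji x y (by omega) (by omega)) u h'.ui
    obtain ⟨c, hc⟩ := exists_add_of_le hle
    have hdeg : degG e (seqSum I (t + 1)) = degG e (seqSum J t + Finsupp.single f 1) := by
      rw [seqSum_succ, degG_add, degG_add, hb.degG_single, hb.degG_single, hyb, ← hI0,
        ← add_assoc, ← add_assoc, h'.degG_path hb t]
    have hkN : k = N := by rw [← hN, hu, seqSum_degree]
    have hP1 : P (seqSum I (t + 1)) (seqSum J t + Finsupp.single f 1) :=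
      IH (t + 1) (by omega) _ _ (seqSum_degree _ _) hdeg
    have hP2 : P u (seqSum J t + Finsupp.single f 1 + c) := by
      rw [hc]
      exact P.add hP1 (P.refl c)
    have hdu : degG e u = degG e (seqSum J t + Finsupp.single f 1 + c) := by
      rw [hc, degG_add, degG_add _ _ c, hdeg]
    refine P.trans hP2 (hshare _ _ ?_ (hdu.symm.trans huv) (J 0) ?_ (h'.vj 0))
    · rw [← hb.degree_eq hdu, hN]
    · have : 0 < seqSum J t (J 0) := by
        obtain ⟨t', rfl⟩ : ∃ t', t = t' + 1 := ⟨t - 1, by omega⟩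
        unfold seqSum
        rw [Finset.sum_range_succ', Finsupp.add_apply]
        simp
      simp only [Finsupp.add_apply]
      omega
  obtain ⟨hu, hv⟩ := hfull k i j h
  have hij : ∀ s t, i s ≠ j t := fun s t hst => hdisj (i s) (h.ui s) (hst ▸ h.vj t)
  obtain ⟨p, q, hpq, hdpq, hsupp, hPpq, hmin⟩ := hP u v huv hne
  have hloc : ∀ r : Fin m →₀ ℕ, degG e r = degG e p → ∀ x, 0 < r x →
      (∃ t, i t = x) ∨ (∃ t, j t = x) := by
    intro r hr x hx
    have h1 : degG e u (a x) ≠ 0 := fun h0 => hb.pos_a hx (by rw [hr]; exact hsupp _ h0)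
    have h2 : degG e u (b x) ≠ 0 := fun h0 => hb.pos_b hx (by rw [hr]; exact hsupp _ h0)
    rcases hchord x h1 h2 with h3 | h3
    · rw [hu] at h3
      obtain ⟨t, -, ht⟩ := seqSum_pos _ _ _ h3
      exact Or.inl ⟨t, ht⟩
    · rw [hv] at h3
      obtain ⟨t, -, ht⟩ := seqSum_pos _ _ _ h3
      exact Or.inr ⟨t, ht⟩
  have hB : ∀ r : Fin m →₀ ℕ, degG e r = degG e p → ∀ t,
      degG e p (b (i t)) = (r (i t) : ℤ) + r (j t) := by
    intro r hr t
    rw [← hr]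
    refine degG_two (hij t t) ((hb.mem _ _).2 (Or.inr rfl)) ((hb.mem _ _).2 (Or.inr (h.bb t))) ?_
    intro z hz hm
    have hz' : b z = b (i t) := by
      rcases (hb.mem _ _).1 hm with h1 | h1
      · exact absurd h1.symm (hb.ne _ _)
      · exact h1.symm
    rcases hloc r hr z hz with ⟨s, rfl⟩ | ⟨s, rfl⟩
    · exact Or.inl (h.injb s t hz').1
    · exact Or.inr (h.injb s t ((h.bb s).trans hz')).2
  have hA : ∀ r : Fin m →₀ ℕ, degG e r = degG e p → ∀ t,
      degG e p (a (j t)) = (r (i (t + 1)) : ℤ) + r (j t) := by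
    intro r hr t
    rw [← hr]
    refine degG_two (hij _ t) ((hb.mem _ _).2 (Or.inl (h.aa t).symm))
      ((hb.mem _ _).2 (Or.inl rfl)) ?_
    intro z hz hm
    have hz' : a z = a (j t) := by
      rcases (hb.mem _ _).1 hm with h1 | h1
      · exact h1.symm
      · exact absurd h1 (hb.ne _ _)
    rcases hloc r hr z hz with ⟨s, rfl⟩ | ⟨s, rfl⟩
    · exact Or.inl (h.inja s (t + 1) (hz'.trans (h.aa t).symm))
    · exact Or.inr (h.inja' s t hz').2
  have hc : ∀ t, (p (i t) : ℤ) - q (i t) = p (i 0) - q (i 0) := by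
    intro t
    induction t with
    | zero => rfl
    | succ t ih =>
      have h1 := hB p rfl t
      have h2 := hB q hdpq.symm t
      have h3 := hA p rfl t
      have h4 := hA q hdpq.symm t
      omega
  have hc' : ∀ t, (q (j t) : ℤ) - p (j t) = p (i 0) - q (i 0) := by
    intro t
    have h1 := hB p rfl t
    have h2 := hB q hdpq.symm t
    have h3 := hc t
    omega
  have hfin : ∀ r s : Fin m →₀ ℕ, degG e r = degG e s → r.degree = s.degree → r ≤ s → r = s := by
    intro r s _ hd hle
    obtain ⟨z, rfl⟩ := exists_add_of_le hle
    rw [map_add] at hd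
    have : z = 0 := (Finsupp.degree_eq_zero_iff z).1 (by omega)
    rw [this, add_zero]
  have hle : ∀ f : ℕ → Fin m, (∀ s t, s < k → t < k → f s = f t → s = t) →
      ∀ r : Fin m →₀ ℕ, (∀ t, 0 < r (f t)) → seqSum f k ≤ r := fun f hf r hr =>
    seqSum_le f k hf r hr
  have hconcl : ∀ x y z w : Fin m →₀ ℕ, x ≤ z → y ≤ w → z.degree ≤ x.degree →
      degG e x = degG e y → degG e z = degG e w → x = z ∧ y = w := by
    intro x y z w hxz hyw hd hxy hzw
    obtain ⟨z', rfl⟩ := exists_add_of_le hxz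
    obtain ⟨w', rfl⟩ := exists_add_of_le hyw
    rw [map_add] at hd
    have hz' : z' = 0 := (Finsupp.degree_eq_zero_iff z').1 (by omega)
    subst hz'
    rw [add_zero, degG_add, ← hxy] at hzw
    have : degG e w' = 0 := by simpa using hzw.symm
    rw [hb.eq_zero this]
    simp
  rcases lt_trichotomy ((p (i 0) : ℤ) - q (i 0)) 0 with hneg | hzero | hpos
  · have h1 : u ≤ q := by
      rw [hu]
      refine hle i h.inji q fun t => ?_
      have := hc t
      omega
    have h2 : v ≤ p := by
      rw [hv]
      refine hle j h.injj p fun t => ?_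
      have := hc' t
      omega
    have h3 := hmin v u hne.symm huv.symm (fun w hw => degG_mono e h2 hw)
    obtain ⟨rfl, rfl⟩ := hconcl v u p q h2 h1 h3 huv.symm hdpq
    exact hbad (P.symm hPpq)
  · apply hpq
    ext x
    by_cases hx : 0 < p x ∨ 0 < q x
    · have : (∃ t, i t = x) ∨ (∃ t, j t = x) := by
        rcases hx with hx | hx
        · exact hloc p rfl x hx
        · exact hloc q hdpq.symm x hx
      rcases this with ⟨t, rfl⟩ | ⟨t, rfl⟩
      · have := hc t
        omega
      · have := hc' t
        omega
    · omega
  · have h1 : u ≤ p := by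
      rw [hu]
      refine hle i h.inji p fun t => ?_
      have := hc t
      omega
    have h2 : v ≤ q := by
      rw [hv]
      refine hle j h.injj q fun t => ?_
      have := hc' t
      omega
    have h3 := hmin u v hne huv (fun w hw => degG_mono e h1 hw)
    obtain ⟨rfl, rfl⟩ := hconcl u v p q h1 h2 h3 huv hdpq
    exact hbad hPpq

end

/-! ### The toric map on monomials -/

section
variable {K : Type*} [Field K] {n m : ℕ} {e : Fin m → Sym2 (Fin n)}

/-- The `G`-degree with natural number entries. -/
def degN (e : Fin m → Sym2 (Fin n)) (u : Fin m →₀ ℕ) : Fin n →₀ ℕ :=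
  Finsupp.equivFunOnFinite.symm fun j => ∑ i, u i * incid e i j

lemma degN_eq_iff (u v : Fin m →₀ ℕ) : degN e u = degN e v ↔ degG e u = degG e v := by
  unfold degN degG
  rw [Equiv.apply_eq_iff_eq, funext_iff, funext_iff]
  refine forall_congr' fun j => ?_
  exact_mod_cast Iff.rfl

lemma toricMap_monomial (u : Fin m →₀ ℕ) (c : K) :
    toricMap K e (monomial u c) = monomial (degN e u) c := by
  rw [toricMap, aeval_monomial, monomial_eq, Finsupp.prod_fintype _ _ (by simp),
    Finsupp.prod_fintype _ _ (by simp)]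
  congr 1
  simp_rw [← Finset.prod_pow]
  rw [Finset.prod_comm]
  refine Finset.prod_congr rfl fun j _ => ?_
  simp_rw [← pow_mul]
  rw [Finset.prod_pow_eq_pow_sum]
  congr 1
  simp [degN, mul_comm]

lemma binomial_mem {u v : Fin m →₀ ℕ} (h : degG e u = degG e v) :
    (monomial u 1 - monomial v 1 : MvPolynomial (Fin m) K) ∈ toricIdeal K e := by
  rw [toricIdeal, RingHom.mem_ker, map_sub, toricMap_monomial, toricMap_monomial,
    (degN_eq_iff u v).2 h, sub_self]

lemma toricIdeal_le (J : Ideal (MvPolynomial (Fin m) K))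
    (hJ : ∀ u v : Fin m →₀ ℕ, degG e u = degG e v →
      (monomial u 1 - monomial v 1 : MvPolynomial (Fin m) K) ∈ J) : toricIdeal K e ≤ J := by
  have hr : ∀ d : Fin n →₀ ℕ, ∃ r : Fin m →₀ ℕ, (∃ u, degN e u = d) → degN e r = d := by
    intro d
    by_cases hd : ∃ u, degN e u = d
    · exact ⟨hd.choose, fun _ => hd.choose_spec⟩
    · exact ⟨0, fun h => absurd h hd⟩
  choose r hr using hr
  let ρ : MvPolynomial (Fin n) K →ₗ[K] MvPolynomial (Fin m) K :=
    (basisMonomials (Fin n) K).constr K fun d => monomial (r d) 1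
  have hρ : ∀ d c, ρ (monomial d c) = monomial (r d) c := by
    intro d c
    have h1 : (monomial d c : MvPolynomial (Fin n) K) = c • basisMonomials (Fin n) K d := by
      simp [smul_monomial]
    rw [h1, map_smul, Module.Basis.constr_basis, smul_monomial, smul_eq_mul, mul_one]
  have key : ∀ f : MvPolynomial (Fin m) K, f - ρ (toricMap K e f) ∈ J := by
    intro f
    induction f using MvPolynomial.induction_on' with
    | monomial u c =>
      rw [toricMap_monomial, hρ]
      have h1 : (monomial u c - monomial (r (degN e u)) c : MvPolynomial (Fin m) K)
          = C c * (monomial u 1 - monomial (r (degN e u)) 1) := by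
        rw [mul_sub, C_mul_monomial, C_mul_monomial, mul_one]
      rw [h1]
      exact J.mul_mem_left _ (hJ _ _ ((degN_eq_iff _ _).1 (hr _ ⟨u, rfl⟩).symm))
    | add f g hf hg =>
      rw [map_add, map_add, add_sub_add_comm]
      exact J.add_mem hf hg
  intro f hf
  have := key f
  rw [toricIdeal, RingHom.mem_ker] at hf
  rwa [hf, map_zero, sub_zero] at this

/-- Coefficients of singleton fibres vanish on the toric ideal. -/
lemma coeff_eq_zero {f : MvPolynomial (Fin m) K} (hf : f ∈ toricIdeal K e) {u : Fin m →₀ ℕ}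
    (hu : ∀ v, degG e v = degG e u → v = u) : coeff u f = 0 := by
  have key : ∀ f : MvPolynomial (Fin m) K, coeff (degN e u) (toricMap K e f) = coeff u f := by
    intro f
    induction f using MvPolynomial.induction_on' with
    | monomial v c =>
      rw [toricMap_monomial, coeff_monomial, coeff_monomial]
      refine if_congr ⟨fun h => hu v ((degN_eq_iff _ _).1 h), fun h => by rw [h]⟩ rfl rfl
    | add f g hf hg => rw [map_add, coeff_add, coeff_add, hf, hg]
  rw [toricIdeal, RingHom.mem_ker] at hf
  rw [← key, hf, coeff_zero]

end

/-! ### Minimal cyclic vertex sets -/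

section
variable {K : Type*} [Field K] {n m : ℕ} {e : Fin m → Sym2 (Fin n)}

/-- The support of the degree of an exponent vector. -/
def dsupp (e : Fin m → Sym2 (Fin n)) (u : Fin m →₀ ℕ) : Finset (Fin n) :=
  Finset.univ.filter fun w => degG e u w ≠ 0

lemma mem_dsupp (u : Fin m →₀ ℕ) (w : Fin n) : w ∈ dsupp e u ↔ degG e u w ≠ 0 := by
  simp [dsupp]

lemma dsupp_congr {u v : Fin m →₀ ℕ} (h : degG e u = degG e v) : dsupp e u = dsupp e v := by
  unfold dsupp; rw [h]

lemma dsupp_mono {u v : Fin m →₀ ℕ} (h : u ≤ v) : dsupp e u ⊆ dsupp e v := fun w hw => by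
  rw [mem_dsupp] at hw ⊢
  exact fun h0 => hw (degG_mono e h h0)

/-- `W` supports two distinct exponent vectors of the same degree. -/
def Cyclic (e : Fin m → Sym2 (Fin n)) (W : Finset (Fin n)) : Prop :=
  ∃ u v, u ≠ v ∧ degG e u = degG e v ∧ dsupp e u ⊆ W

lemma exists_pair {W : Finset (Fin n)} (hW : Cyclic e W) :
    ∃ r : (Fin m →₀ ℕ) × (Fin m →₀ ℕ), r.1 ≠ r.2 ∧ degG e r.1 = degG e r.2 ∧ dsupp e r.1 ⊆ W ∧
      ∀ p' q', p' ≠ q' → degG e p' = degG e q' → dsupp e p' ⊆ W → r.1.degree ≤ p'.degree := by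
  classical
  have hex : ∃ d, ∃ u v, u ≠ v ∧ degG e u = degG e v ∧ dsupp e u ⊆ W ∧ u.degree = d := by
    obtain ⟨u, v, h1, h2, h3⟩ := hW
    exact ⟨_, u, v, h1, h2, h3, rfl⟩
  obtain ⟨u, v, h1, h2, h3, h4⟩ := Nat.find_spec hex
  refine ⟨(u, v), h1, h2, h3, fun p' q' h1' h2' h3' => ?_⟩
  show u.degree ≤ _
  rw [h4]
  exact Nat.find_min' hex ⟨p', q', h1', h2', h3', rfl⟩

/-- The set of minimal cyclic vertex sets (the vertex sets of chordless cycles). -/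
abbrev MinCyc (e : Fin m → Sym2 (Fin n)) : Type := {W : Finset (Fin n) // Minimal (Cyclic e) W}

/-- The exponent pair attached to a minimal cyclic set. -/
def pr (W : MinCyc e) : (Fin m →₀ ℕ) × (Fin m →₀ ℕ) := (exists_pair W.2.prop).choose

lemma pr_ne (W : MinCyc e) : (pr W).1 ≠ (pr W).2 := (exists_pair W.2.prop).choose_spec.1

lemma pr_deg (W : MinCyc e) : degG e (pr W).1 = degG e (pr W).2 :=
  (exists_pair W.2.prop).choose_spec.2.1

lemma pr_min (W : MinCyc e) : ∀ p' q', p' ≠ q' → degG e p' = degG e q' → dsupp e p' ⊆ W.1 →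
    (pr W).1.degree ≤ p'.degree :=
  (exists_pair W.2.prop).choose_spec.2.2.2

lemma pr_supp (W : MinCyc e) : dsupp e (pr W).1 = W.1 := by
  have hs : dsupp e (pr W).1 ⊆ W.1 := (exists_pair W.2.prop).choose_spec.2.2.1
  exact hs.antisymm (W.2.le_of_le ⟨_, _, pr_ne W, pr_deg W, subset_rfl⟩ hs)

/-- The binomial attached to a minimal cyclic set. -/
def bin (K : Type*) [Field K] (W : MinCyc e) : MvPolynomial (Fin m) K :=
  monomial (pr W).1 1 - monomial (pr W).2 1

lemma bin_mem (W : MinCyc e) : bin K W ∈ toricIdeal K e := binomial_mem (pr_deg W)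

lemma bin_support (W : MinCyc e) {u : Fin m →₀ ℕ} (hu : u ∈ (bin K W).support) :
    u = (pr W).1 ∨ u = (pr W).2 := by
  classical
  by_contra hne
  push Not at hne
  rw [mem_support_iff] at hu
  apply hu
  rw [bin, coeff_sub, coeff_monomial, coeff_monomial, if_neg hne.1.symm, if_neg hne.2.symm, sub_self]

lemma bin_hom (W : MinCyc e) : IsGHomogeneous e (bin K W) := by
  have h : ∀ u ∈ (bin K W).support, degG e u = degG e (pr W).1 := by
    intro u hu
    rcases bin_support W hu with rfl | rfl
    · rfl
    · exact (pr_deg W).symm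
  intro u hu v hv
  rw [h u hu, h v hv]

lemma bin_coeff (W W' : MinCyc e) [Decidable (W = W')] :
    coeff (pr W').1 (bin K W) = if W = W' then 1 else 0 := by
  classical
  rw [bin, coeff_sub, coeff_monomial, coeff_monomial]
  by_cases h : W = W'
  · subst h
    rw [if_pos rfl, if_neg (pr_ne W).symm, if_pos rfl, sub_zero]
  · have h1 : ¬ (pr W).1 = (pr W').1 := by
      intro h1
      apply h
      apply Subtype.ext
      rw [← pr_supp W, ← pr_supp W', h1]
    have h2 : ¬ (pr W).2 = (pr W').1 := by
      intro h2
      apply h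
      apply Subtype.ext
      rw [← pr_supp W, ← pr_supp W', dsupp_congr (pr_deg W), h2]
    rw [if_neg h1, if_neg h2, if_neg h, sub_zero]

/-- The congruence attached to an ideal. -/
def idealCon (J : Ideal (MvPolynomial (Fin m) K)) : AddCon (Fin m →₀ ℕ) where
  r u v := (monomial u 1 - monomial v 1 : MvPolynomial (Fin m) K) ∈ J
  iseqv := ⟨fun u => by simp, fun {u v} h => by
      rw [← neg_sub]; exact J.neg_mem h, fun {u v w} h1 h2 => by
      have := J.add_mem h1 h2
      rwa [sub_add_sub_cancel] at this⟩
  add' := by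
    intro u v w x h1 h2
    have h3 := J.add_mem (J.mul_mem_right (monomial w 1) h1) (J.mul_mem_left (monomial v 1) h2)
    rw [sub_mul, mul_sub, sub_add_sub_cancel] at h3
    simpa [monomial_mul] using h3

lemma idealCon_iff (J : Ideal (MvPolynomial (Fin m) K)) (u v : Fin m →₀ ℕ) :
    idealCon J u v ↔ (monomial u 1 - monomial v 1 : MvPolynomial (Fin m) K) ∈ J := Iff.rfl

/-- The toric ideal of a bipartite graph is generated by the binomials `bin W`. -/
theorem span_bin {a b : Fin m → Fin n} (hb : Bip e a b) :
    Ideal.span (Set.range (bin K : MinCyc e → _)) = toricIdeal K e := by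
  apply le_antisymm
  · rw [Ideal.span_le]
    rintro _ ⟨W, rfl⟩
    exact bin_mem W
  · apply toricIdeal_le
    intro u v huv
    rw [← idealCon_iff]
    refine hb.core _ ?_ _ u v rfl huv
    intro u v huv hne
    have hC : Cyclic e (dsupp e u) := ⟨u, v, hne, huv, subset_rfl⟩
    obtain ⟨W, hW, hmin⟩ := exists_minimal_le_of_wellFoundedLT (Cyclic e) _ hC
    refine ⟨(pr ⟨W, hmin⟩).1, (pr ⟨W, hmin⟩).2, pr_ne _, pr_deg _, ?_, ?_, ?_⟩
    · intro w hw
      by_contra h0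
      have h1 : w ∈ dsupp e (pr ⟨W, hmin⟩).1 := (mem_dsupp _ _).2 h0
      rw [pr_supp] at h1
      exact (mem_dsupp _ _).1 (hW h1) hw
    · exact Ideal.subset_span ⟨_, rfl⟩
    · intro p' q' h1 h2 h3
      refine pr_min _ p' q' h1 h2 ?_
      rw [← pr_supp]
      intro w hw
      rw [mem_dsupp] at hw ⊢
      exact fun h0 => hw (h3 w h0)

/-- Lower bound for the number of generators. -/
theorem card_le_of_span [Fintype (MinCyc e)] {s : ℕ} (F : Fin s → MvPolynomial (Fin m) K)
    (hF : Ideal.span (Set.range F) = toricIdeal K e) : Fintype.card (MinCyc e) ≤ s := by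
  classical
  let L : MvPolynomial (Fin m) K →ₗ[K] (MinCyc e → K) :=
    LinearMap.pi fun W => lcoeff K (pr W).1
  have hL : ∀ f W, L f W = coeff (pr W).1 f := fun f W => rfl
  have hmul : ∀ f ∈ toricIdeal K e, ∀ g, L (g * f) = coeff 0 g • L f := by
    intro f hf g
    funext W
    rw [Pi.smul_apply, hL, hL, coeff_mul, smul_eq_mul, Finset.sum_eq_single (0, (pr W).1)]
    · rintro ⟨x, y⟩ hxy hne
      rw [Finset.HasAntidiagonal.mem_antidiagonal] at hxy
      simp only at hxy
      have hx : x ≠ 0 := by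
        rintro rfl
        apply hne
        rw [← hxy, zero_add]
      have hy : coeff y f = 0 := by
        apply coeff_eq_zero hf
        intro v hv
        by_contra hvy
        have h1 := pr_min W y v (Ne.symm hvy) hv.symm (by
          rw [← pr_supp W, ← hxy]
          exact dsupp_mono le_add_self)
        rw [← hxy, map_add] at h1
        exact hx ((Finsupp.degree_eq_zero_iff x).1 (by omega))
      rw [hy, mul_zero]
    · intro h
      simp at h
  have hmem : ∀ f ∈ toricIdeal K e, L f ∈ Submodule.span K (Set.range fun i => L (F i)) := by
    intro f hf
    rw [← hF] at hf
    obtain ⟨c, rfl⟩ := (Ideal.mem_span_range_iff_exists_fun).1 hf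
    rw [map_sum]
    refine Submodule.sum_mem _ fun i _ => ?_
    rw [hmul (F i) (by rw [← hF]; exact Ideal.subset_span ⟨i, rfl⟩)]
    exact Submodule.smul_mem _ _ (Submodule.subset_span ⟨i, rfl⟩)
  have htop : Submodule.span K (Set.range fun i => L (F i)) = ⊤ := by
    rw [eq_top_iff, ← (Pi.basisFun K (MinCyc e)).span_eq, Submodule.span_le]
    rintro _ ⟨W, rfl⟩
    have : Pi.basisFun K (MinCyc e) W = L (bin K W) := by
      funext W'
      rw [hL, bin_coeff, Pi.basisFun_apply, Pi.single_apply]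
      simp only [eq_comm]
    rw [this]
    exact hmem _ (bin_mem W)
  have h1 := finrank_range_le_card (R := K) (fun i => L (F i))
  rw [Set.finrank, htop, finrank_top, Module.finrank_fintype_fun_eq_card, Fintype.card_fin] at h1
  exact h1

/-- Lower bound for the homogeneous arithmetical rank. -/
theorem card_le_of_radical [Fintype (MinCyc e)] {s : ℕ} (F : Fin s → MvPolynomial (Fin m) K)
    (hhom : ∀ i, IsGHomogeneous e (F i)) (hmem : ∀ i, F i ∈ toricIdeal K e)
    (hF : (Ideal.span (Set.range F)).radical = toricIdeal K e) :
    Fintype.card (MinCyc e) ≤ s := by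
  classical
  have key : ∀ W : MinCyc e, ∃ i, ∃ u ∈ (F i).support, dsupp e u = W.1 := by
    intro W
    by_contra hno
    push Not at hno
    let S : Set (Fin m) := {i | ¬ ∀ w ∈ e i, w ∈ W.1}
    let ψ : MvPolynomial (Fin m) K →ₐ[K] MvPolynomial (Fin m) K :=
      aeval fun i => if i ∈ S then 0 else X i
    have hψ0 : ∀ i, ψ (F i) = 0 := by
      intro i
      have h1 : F i ∈ Ideal.span (X '' S : Set (MvPolynomial (Fin m) K)) := by
        rw [mem_ideal_span_X_image]
        intro u hu
        by_contra hc
        push Not at hc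
        have hsub : dsupp e u ⊆ W.1 := by
          intro w hw
          obtain ⟨x, hx, hwx⟩ := (degG_ne_zero_iff e u w).1 ((mem_dsupp _ _).1 hw)
          by_contra hwW
          have := hc x (fun hall => hwW (hall w hwx))
          omega
        have hcyc : Cyclic e (dsupp e u) := by
          by_contra hncyc
          rw [mem_support_iff] at hu
          apply hu
          apply coeff_eq_zero (hmem i)
          intro v hv
          by_contra hvu
          exact hncyc ⟨u, v, Ne.symm hvu, hv.symm, subset_rfl⟩
        exact hno i u hu (hsub.antisymm (W.2.le_of_le hcyc hsub))
      have h2 : Ideal.span (X '' S : Set (MvPolynomial (Fin m) K)) ≤ RingHom.ker ψ := by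
        rw [Ideal.span_le]
        rintro _ ⟨x, hx, rfl⟩
        rw [SetLike.mem_coe, RingHom.mem_ker]
        simp only [ψ, aeval_X, if_pos hx]
      exact h2 h1
    have hψm : ∀ u : Fin m →₀ ℕ, dsupp e u ⊆ W.1 →
        ψ (monomial u 1) = monomial u 1 := by
      intro u hu
      simp only [ψ]
      rw [aeval_monomial, map_one, one_mul, monomial_eq, C_1, one_mul]
      refine Finsupp.prod_congr fun x hx => ?_
      rw [if_neg]
      intro hxS
      apply hxS
      intro w hw
      apply hu
      rw [mem_dsupp, degG_ne_zero_iff]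
      exact ⟨x, Nat.pos_of_ne_zero (Finsupp.mem_support_iff.1 hx), hw⟩
    have hB : bin K W ∈ (Ideal.span (Set.range F)).radical := by
      rw [hF]; exact bin_mem W
    have hle : (Ideal.span (Set.range F)).radical ≤ RingHom.ker ψ := by
      have hp : (RingHom.ker ψ).IsPrime := RingHom.ker_isPrime _
      rw [hp.radical_le_iff, Ideal.span_le]
      rintro _ ⟨i, rfl⟩
      exact hψ0 i
    have h0 := hle hB
    rw [RingHom.mem_ker, bin, map_sub, hψm _ (pr_supp W).subset,
      hψm _ (by rw [← dsupp_congr (pr_deg W)]; exact (pr_supp W).subset)] at h0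
    have h1 := bin_coeff (K := K) W W
    rw [bin, h0, coeff_zero, if_pos rfl] at h1
    exact zero_ne_one h1
  choose f u hu hW using key
  have hinj : Function.Injective f := by
    intro W W' h
    apply Subtype.ext
    rw [← hW W, ← hW W']
    apply dsupp_congr
    apply hhom (f W) _ (hu W)
    rw [h]
    exact hu W'
  simpa using Fintype.card_le_of_injective f hinj

end

/-- For a finite connected bipartite graph `G`, the `G`-homogeneous
arithmetical rank of the toric ideal `I_G` equals its minimal number of generators. -/
theorem araG_toricIdeal_eq_mu_of_bipartite {K : Type*} [Field K] [IsAlgClosed K]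
    {n m : ℕ} (e : Fin m → Sym2 (Fin n))
    (he : Function.Injective e) (hl : ∀ i, ¬ (e i).IsDiag)
    (hconn : (SimpleGraph.fromEdgeSet (Set.range e)).Connected)
    (hbip : IsBipartite e) :
    araG e (toricIdeal K e) = mu (toricIdeal K e) := by
  classical
  obtain ⟨a, b, hb⟩ := exists_bip e he hbip
  let N := Fintype.card (MinCyc e)
  let F : Fin N → MvPolynomial (Fin m) K := fun i => bin K ((Fintype.equivFin (MinCyc e)).symm i)
  have hrange : Set.range F = Set.range (bin K : MinCyc e → _) :=
    (Fintype.equivFin (MinCyc e)).symm.surjective.range_comp (bin K)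
  have hspan : Ideal.span (Set.range F) = toricIdeal K e := by rw [hrange, span_bin hb]
  have hprime : (toricIdeal K e).IsPrime := RingHom.ker_isPrime _
  have h1 : araG e (toricIdeal K e) = N := by
    apply le_antisymm
    · exact Nat.sInf_le ⟨F, fun i => bin_hom _, fun i => bin_mem _, by
        rw [hspan]; exact hprime.isRadical.radical⟩
    · refine le_csInf ⟨N, F, fun i => bin_hom _, fun i => bin_mem _, by
        rw [hspan]; exact hprime.isRadical.radical⟩ ?_
      rintro s ⟨F', h1, h2, h3⟩
      exact card_le_of_radical F' h1 h2 h3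
  have h2 : mu (toricIdeal K e) = N := by
    apply le_antisymm
    · exact Nat.sInf_le ⟨F, hspan⟩
    · refine le_csInf ⟨N, F, hspan⟩ ?_
      rintro s ⟨F', h⟩
      exact card_le_of_span F' h
  rw [h1, h2]
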